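/- Let (Σ, T, μ) be an ergodic measure-preserving shift system with positive entropy h_μ(T) > 0. Then sup_{a ∈ Σ} μ(τ_{[a_0 … a_{n−1}]} ≤ n) → 0 as n → ∞; that is, for every point a (including periodic points) the probability of hitting the cylinder [a_0 … a_{n−1}] within n steps tends to zero, uniformly in a. -/

import Mathlib

open MeasureTheory Filter Set
open scoped ENNReal Topology

noncomputable section

/-- First hitting time (at time ≥ 1) of the set `A` under `T`, valued in `ℕ∞`. -/
def hitTime {X : Type*} (T : X → X) (A : Set X) (x : X) : ℕ∞ :=
  ⨅ k ∈ {k : ℕ | 1 ≤ k ∧ T^[k] x ∈ A}, (k : ℕ∞)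

/-- The shift map on one-sided sequences. -/
def shift (𝒜 : Type*) : (ℕ → 𝒜) → (ℕ → 𝒜) := fun x n => x (n + 1)

/-- `n`-th term of the sequence whose limit (as `n → ∞`) is the Kolmogorov–Sinai entropy
`h_μ(T)` of the shift: `-(1/n) ∑_{C cylinder of rank n} μ(C) log μ(C)`. -/
def entropySeq {𝒜 : Type*} [MeasurableSpace 𝒜] (μ : Measure (ℕ → 𝒜)) (n : ℕ) : ℝ :=
  -(1 / (n : ℝ)) * ∑' w : Fin n → 𝒜,
    (μ {y | ∀ i : Fin n, y (i : ℕ) = w i}).toReal *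
      Real.log (μ {y | ∀ i : Fin n, y (i : ℕ) = w i}).toReal


namespace HitCyl

set_option linter.unusedSectionVars false

variable {𝒜 : Type*} [Countable 𝒜] [MeasurableSpace 𝒜] [DiscreteMeasurableSpace 𝒜]

/-- measure of the rank `n` cylinder around `x` -/
def cy (μ : Measure (ℕ → 𝒜)) (n : ℕ) (x : ℕ → 𝒜) : ℝ := μ.real {y | ∀ i < n, y i = x i}

lemma shift_iter (k : ℕ) (x : ℕ → 𝒜) (n : ℕ) : (shift 𝒜)^[k] x n = x (n + k) := by
  induction k generalizing x n with
  | zero => rfl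
  | succ k ih =>
    rw [Function.iterate_succ_apply, ih]
    simp only [shift]; congr 1

lemma measurable_proj (n s : ℕ) :
    Measurable (fun (x : ℕ → 𝒜) (i : Fin n) => x (i + s)) := by fun_prop

lemma meas_cyl (n : ℕ) (x : ℕ → 𝒜) : MeasurableSet {y : ℕ → 𝒜 | ∀ i < n, y i = x i} := by
  have : {y : ℕ → 𝒜 | ∀ i < n, y i = x i} = ⋂ i, ⋂ (_ : i < n), (fun y : ℕ → 𝒜 => y i) ⁻¹' {x i} := by
    ext y; simp
  rw [this]
  exact MeasurableSet.iInter fun i => MeasurableSet.iInter fun _ =>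
    (measurable_pi_apply i) (MeasurableSet.singleton _)

variable {μ : Measure (ℕ → 𝒜)} [IsProbabilityMeasure μ]

lemma measurable_cy (n : ℕ) : Measurable (cy μ n) := by
  have : cy μ n = (fun w : Fin n → 𝒜 => μ.real {y | ∀ i : Fin n, y i = w i}) ∘
      (fun (x : ℕ → 𝒜) (i : Fin n) => x (i + 0)) := by
    funext x
    simp [cy, Fin.forall_iff]
  rw [this]
  exact (Measurable.of_discrete).comp (measurable_proj n 0)

lemma cy_anti {m n : ℕ} (hmn : m ≤ n) (x : ℕ → 𝒜) : cy μ n x ≤ cy μ m x :=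
  measureReal_mono (fun _ hy i hi => hy i (lt_of_lt_of_le hi hmn))

lemma cy_nonneg (n : ℕ) (x : ℕ → 𝒜) : 0 ≤ cy μ n x := measureReal_nonneg

lemma cy_le_one (n : ℕ) (x : ℕ → 𝒜) : cy μ n x ≤ 1 := measureReal_le_one

lemma cy_shift (hT : MeasurePreserving (shift 𝒜) μ μ) (n : ℕ) (x : ℕ → 𝒜) :
    cy μ n (shift 𝒜 x) = μ.real {y | ∀ i < n, y (i + 1) = x (i + 1)} := by
  unfold cy
  rw [← hT.measureReal_preimage (meas_cyl n _).nullMeasurableSet]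
  rfl

lemma cy_succ_le (hT : MeasurePreserving (shift 𝒜) μ μ) (n : ℕ) (x : ℕ → 𝒜) :
    cy μ (n + 1) x ≤ cy μ n (shift 𝒜 x) := by
  rw [cy_shift hT]
  exact measureReal_mono (fun y hy i hi => hy (i + 1) (by omega))

lemma cy_add_le (hT : MeasurePreserving (shift 𝒜) μ μ) (k s : ℕ) (x : ℕ → 𝒜) :
    cy μ (k + s) x ≤ cy μ k ((shift 𝒜)^[s] x) := by
  induction s generalizing x with
  | zero => rfl
  | succ s ih => exact (cy_succ_le hT (k + s) x).trans (ih _)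

/-- set of points with a good loss -/
def Bset (μ : Measure (ℕ → 𝒜)) (K : ℕ) (r : ℝ) : Set (ℕ → 𝒜) :=
  {x | ∀ k ≥ K, cy μ (k + 1) x ≤ r * cy μ k (shift 𝒜 x)}

def Vset (μ : Measure (ℕ → 𝒜)) (K R : ℕ) (r : ℝ) : Set (ℕ → 𝒜) :=
  {x | ∀ k ≥ K, cy μ (k + R) x ≤ r * cy μ k ((shift 𝒜)^[R] x)}

lemma measurable_shift : Measurable (shift 𝒜) := by
  unfold shift; fun_prop

lemma meas_B (K : ℕ) (r : ℝ) : MeasurableSet (Bset μ K r) := by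
  have : Bset μ K r = ⋂ k, ⋂ (_ : k ≥ K), {x | cy μ (k + 1) x ≤ r * cy μ k (shift 𝒜 x)} := by
    ext; simp [Bset]
  rw [this]
  exact MeasurableSet.iInter fun k => MeasurableSet.iInter fun _ =>
    measurableSet_le (measurable_cy _) (((measurable_cy k).comp measurable_shift).const_mul r)

lemma meas_V (K R : ℕ) (r : ℝ) : MeasurableSet (Vset μ K R r) := by
  have : Vset μ K R r = ⋂ k, ⋂ (_ : k ≥ K),
      {x | cy μ (k + R) x ≤ r * cy μ k ((shift 𝒜)^[R] x)} := by
    ext; simp [Vset]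
  rw [this]
  exact MeasurableSet.iInter fun k => MeasurableSet.iInter fun _ =>
    measurableSet_le (measurable_cy _)
      (((measurable_cy k).comp (measurable_shift.iterate R)).const_mul r)

lemma mem_V (hT : MeasurePreserving (shift 𝒜) μ μ) {K R j : ℕ} {r : ℝ} (hr : 0 ≤ r) (hj : j < R)
    {x : ℕ → 𝒜} (hx : (shift 𝒜)^[j] x ∈ Bset μ K r) : x ∈ Vset μ K R r := by
  intro k hk
  obtain ⟨s, rfl⟩ : ∃ s, R = (s + 1) + j := ⟨R - j - 1, by omega⟩
  calc cy μ (k + (s + 1 + j)) x = cy μ ((k + s + 1) + j) x := by congr 1; omega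
    _ ≤ cy μ (k + s + 1) ((shift 𝒜)^[j] x) := cy_add_le hT _ _ _
    _ ≤ r * cy μ (k + s) (shift 𝒜 ((shift 𝒜)^[j] x)) := hx _ (by omega)
    _ ≤ r * cy μ k ((shift 𝒜)^[s] (shift 𝒜 ((shift 𝒜)^[j] x))) := by
        gcongr; exact cy_add_le hT _ _ _
    _ = _ := by rw [← Function.iterate_succ_apply, ← Function.iterate_add_apply]

lemma exists_R (hErg : Ergodic (shift 𝒜) μ) {K : ℕ} {r : ℝ} (hr : 0 ≤ r)
    (hB : μ (Bset μ K r) ≠ 0) (δ : ℝ≥0∞) (hδ : 0 < δ) :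
    ∃ R, 0 < R ∧ μ (Vset μ K R r)ᶜ ≤ δ := by
  set B := Bset μ K r
  have hBm : MeasurableSet B := meas_B K r
  set U : Set (ℕ → 𝒜) := ⋃ j, (shift 𝒜)^[j] ⁻¹' B
  have hUm : MeasurableSet U := MeasurableSet.iUnion fun j => (measurable_shift.iterate j) hBm
  have hsub : shift 𝒜 ⁻¹' U ⊆ U := by
    intro x hx
    obtain ⟨j, hj⟩ := mem_iUnion.1 hx
    exact mem_iUnion.2 ⟨j + 1, hj⟩
  have hU : μ Uᶜ = 0 := by
    rcases hErg.ae_empty_or_univ_of_preimage_ae_le hUm.nullMeasurableSet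
      (LE.le.eventuallyLE hsub) with h | h
    · exfalso
      apply hB
      have : μ U = 0 := by rw [measure_congr h]; simp
      exact measure_mono_null (fun x hx => mem_iUnion.2 ⟨0, hx⟩) this
    · rw [measure_congr h.compl]; simp
  have hlim : Tendsto (fun R : ℕ => μ (⋂ j, ⋂ (_ : j < R), ((shift 𝒜)^[j] ⁻¹' B)ᶜ)) atTop
      (𝓝 (μ (⋂ R : ℕ, ⋂ j, ⋂ (_ : j < R), ((shift 𝒜)^[j] ⁻¹' B)ᶜ))) := by
    apply tendsto_measure_iInter_atTop
    · intro R
      exact (MeasurableSet.iInter fun j => MeasurableSet.iInter fun _ =>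
        ((measurable_shift.iterate j) hBm).compl).nullMeasurableSet
    · intro a b hab x hx
      simp only [mem_iInter] at hx ⊢
      exact fun j hj => hx j (lt_of_lt_of_le hj hab)
    · exact ⟨0, measure_ne_top _ _⟩
  have h0 : μ (⋂ R : ℕ, ⋂ j, ⋂ (_ : j < R), ((shift 𝒜)^[j] ⁻¹' B)ᶜ) = 0 := by
    apply measure_mono_null _ hU
    intro x hx
    simp only [mem_iInter] at hx
    intro hxU
    obtain ⟨j, hj⟩ := mem_iUnion.1 hxU
    exact hx (j + 1) j (by omega) hj
  rw [h0] at hlim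
  obtain ⟨R, hR1, hR2⟩ := ((hlim.eventually (ge_mem_nhds hδ)).and (eventually_gt_atTop 0)).exists
  refine ⟨R, hR2, le_trans (measure_mono ?_) hR1⟩
  intro x hx
  simp only [mem_iInter]
  exact fun j hj hjB => hx (mem_V hErg.toMeasurePreserving hr hj hjB)

open Classical in
lemma cy_prod {r : ℝ} (hr0 : 0 ≤ r) {K R : ℕ} (hT : MeasurePreserving (shift 𝒜) μ μ) (L : ℕ)
    (x : ℕ → 𝒜) :
    cy μ (K + L * R) x ≤ ∏ i ∈ Finset.range L,
      (if (shift 𝒜)^[i * R] x ∈ Vset μ K R r then r else 1) := by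
  induction L generalizing x with
  | zero => simpa using cy_le_one _ _
  | succ L ih =>
    rw [Finset.prod_range_succ']
    have h2 : ∀ i, (shift 𝒜)^[(i + 1) * R] x = (shift 𝒜)^[i * R] ((shift 𝒜)^[R] x) := by
      intro i; rw [add_mul, one_mul, Function.iterate_add_apply]
    simp only [h2]
    have h3 : cy μ (K + (L + 1) * R) x = cy μ ((K + L * R) + R) x := by congr 1; ring
    rw [h3]
    simp only [zero_mul, Function.iterate_zero, id]
    have hn : 0 ≤ ∏ i ∈ Finset.range L,
      (if (shift 𝒜)^[i * R] ((shift 𝒜)^[R] x) ∈ Vset μ K R r then r else 1) :=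
      Finset.prod_nonneg fun i _ => by split_ifs <;> simp [hr0]
    split_ifs with hx
    · calc _ ≤ r * cy μ (K + L * R) ((shift 𝒜)^[R] x) := hx _ (by omega)
        _ ≤ r * _ := mul_le_mul_of_nonneg_left (ih _) hr0
        _ = _ := mul_comm _ _
    · rw [mul_one]
      exact (cy_add_le hT _ _ _).trans (ih _)

open Classical in
lemma bad_meas (hT : MeasurePreserving (shift 𝒜) μ μ) {K R : ℕ} {r : ℝ} (hr0 : 0 ≤ r)
    (hr1 : r < 1) {δ : ℝ≥0∞} (hV : μ (Vset μ K R r)ᶜ ≤ δ) (L : ℕ) (hL : 0 < L) :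
    μ {x | r ^ (L / 2) < cy μ (K + L * R) x} ≤ 2 * δ := by
  set V := Vset μ K R r
  have hVm : MeasurableSet V := meas_V K R r
  set Z : (ℕ → 𝒜) → ℝ≥0∞ := fun x => ∑ i ∈ Finset.range L,
    Set.indicator ((shift 𝒜)^[i * R] ⁻¹' Vᶜ) 1 x
  have hZm : Measurable Z := Finset.measurable_sum _ fun i _ =>
    measurable_one.indicator ((measurable_shift.iterate _) hVm.compl)
  have hZint : ∫⁻ x, Z x ∂μ ≤ L * δ := by
    rw [lintegral_finsetSum _ fun i _ =>
      measurable_one.indicator ((measurable_shift.iterate _) hVm.compl)]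
    calc _ ≤ ∑ i ∈ Finset.range L, δ := by
          apply Finset.sum_le_sum
          intro i _
          rw [lintegral_indicator_one ((measurable_shift.iterate _) hVm.compl),
            (hT.iterate _).measure_preimage hVm.compl.nullMeasurableSet]
          exact hV
      _ = _ := by simp
  have hsub : {x | r ^ (L / 2) < cy μ (K + L * R) x} ⊆ {x | (L : ℝ≥0∞) / 2 ≤ Z x} := by
    intro x hx
    by_contra hcon
    simp only [mem_ofPred_eq, not_le] at hcon hx
    have hprod := cy_prod hr0 (K := K) (R := R) hT L x
    rw [Finset.prod_ite, Finset.prod_const, Finset.prod_const, one_pow, mul_one] at hprod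
    have hZ : Z x = ((Finset.range L).filter (fun i => ¬ (shift 𝒜)^[i * R] x ∈ V)).card := by
      simp only [Z, Set.indicator_apply, Finset.card_filter, mem_preimage, mem_compl_iff,
        Pi.one_apply, Nat.cast_sum, Nat.cast_ite, Nat.cast_one, Nat.cast_zero]
    have hcard := Finset.card_filter_add_card_filter_not (s := Finset.range L)
      (fun i => (shift 𝒜)^[i * R] x ∈ V)
    rw [Finset.card_range] at hcard
    rw [hZ, ENNReal.lt_div_iff_mul_lt (by simp) (by simp)] at hcon
    have hcon' : ((Finset.range L).filter (fun i => ¬ (shift 𝒜)^[i * R] x ∈ V)).card * 2 < L := by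
      exact_mod_cast hcon
    have : r ^ ((Finset.range L).filter (fun i => (shift 𝒜)^[i * R] x ∈ V)).card ≤ r ^ (L / 2) :=
      pow_le_pow_of_le_one hr0 hr1.le (by omega)
    linarith
  have hM := mul_meas_ge_le_lintegral hZm (μ := μ) ((L : ℝ≥0∞) / 2)
  have hM' := (hM.trans hZint)
  refine (measure_mono hsub).trans ?_
  have hLne : (L : ℝ≥0∞) ≠ 0 := by simpa using hL.ne'
  have : (L : ℝ≥0∞) * (μ {x | (L : ℝ≥0∞) / 2 ≤ Z x}) ≤ L * (2 * δ) := by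
    calc _ = 2 * ((L : ℝ≥0∞) / 2 * μ {x | (L : ℝ≥0∞) / 2 ≤ Z x}) := by
          rw [← mul_assoc, ENNReal.mul_div_cancel (by simp) (by simp)]
      _ ≤ 2 * (L * δ) := by gcongr
      _ = _ := by ring
  exact (ENNReal.mul_le_mul_iff_right hLne (by simp)).1 this

lemma hit_subset (a : ℕ → 𝒜) (n m : ℕ) (hm : 2 * m ≤ n) :
    {x | hitTime (shift 𝒜) {y | ∀ i < n, y i = a i} x ≤ (n : ℕ∞)} ⊆
      ((shift 𝒜)^[n] ⁻¹' (⋃ i ∈ Finset.range (n + 1), {y | ∀ j < m, y j = a (j + i)})) ∪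
      ((shift 𝒜)^[m] ⁻¹' (⋃ i ∈ Finset.range (n + 1), {y | ∀ j < m, y j = a (j + i)})) := by
  intro x hx
  have : ∃ k, k ≤ n ∧ 1 ≤ k ∧ (shift 𝒜)^[k] x ∈ {y | ∀ i < n, y i = a i} := by
    by_contra hcon
    push Not at hcon
    have : ((n + 1 : ℕ) : ℕ∞) ≤ hitTime (shift 𝒜) {y | ∀ i < n, y i = a i} x := by
      refine le_iInf₂ fun k hk => ?_
      have : ¬ k ≤ n := fun h => hcon k h hk.1 hk.2
      exact_mod_cast (by omega : n + 1 ≤ k)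
    have h2 := this.trans hx
    have : n + 1 ≤ n := by exact_mod_cast h2
    omega
  obtain ⟨k, hkn, hk1, hk⟩ := this
  simp only [mem_ofPred_eq, shift_iter] at hk
  by_cases hkm : m ≤ k
  · left
    simp only [mem_preimage, mem_iUnion, mem_ofPred_eq, shift_iter, Finset.mem_range]
    refine ⟨n - k, by omega, fun j hj => ?_⟩
    rw [← hk (j + (n - k)) (by omega)]
    congr 1; omega
  · right
    simp only [mem_preimage, mem_iUnion, mem_ofPred_eq, shift_iter, Finset.mem_range]
    refine ⟨m - k, by omega, fun j hj => ?_⟩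
    rw [← hk (j + (m - k)) (by omega)]
    congr 1; omega

lemma hit_bound (hT : MeasurePreserving (shift 𝒜) μ μ) (a : ℕ → 𝒜) (n m : ℕ) (hm : 2 * m ≤ n)
    (θ : ℝ) :
    μ {x | hitTime (shift 𝒜) {y | ∀ i < n, y i = a i} x ≤ (n : ℕ∞)} ≤
      2 * (μ {x | θ < cy μ m x} + (n + 1) * ENNReal.ofReal θ) := by
  set W : Set (ℕ → 𝒜) := ⋃ i ∈ Finset.range (n + 1), {y | ∀ j < m, y j = a (j + i)}
  have hWm : MeasurableSet W := by
    refine Finset.measurableSet_biUnion _ fun i _ => ?_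
    exact meas_cyl m (fun j => a (j + i))
  have hW : μ W ≤ μ {x | θ < cy μ m x} + (n + 1) * ENNReal.ofReal θ := by
    have hsub : W ⊆ {x | θ < cy μ m x} ∪ ⋃ i ∈ Finset.range (n + 1),
        ({y | ∀ j < m, y j = a (j + i)} ∩ {x | θ < cy μ m x}ᶜ) := by
      intro x hx
      by_cases hb : x ∈ {x | θ < cy μ m x}
      · exact Or.inl hb
      · right
        simp only [W, mem_iUnion] at hx ⊢
        obtain ⟨i, hi, hx⟩ := hx
        exact ⟨i, hi, hx, hb⟩
    refine (measure_mono hsub).trans ((measure_union_le _ _).trans ?_)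
    gcongr
    refine (measure_biUnion_finset_le _ _).trans ?_
    calc _ ≤ ∑ i ∈ Finset.range (n + 1), ENNReal.ofReal θ := by
          apply Finset.sum_le_sum
          intro i _
          rcases Set.eq_empty_or_nonempty
            ({y | ∀ j < m, y j = a (j + i)} ∩ {x | θ < cy μ m x}ᶜ) with h | ⟨z, hz1, hz2⟩
          · rw [h]; simp
          · refine (measure_mono inter_subset_left).trans ?_
            have : {y : ℕ → 𝒜 | ∀ j < m, y j = a (j + i)} = {y | ∀ j < m, y j = z j} := by
              ext y
              simp only [mem_ofPred_eq] at hz1 ⊢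
              exact forall₂_congr fun j hj => by rw [hz1 j hj]
            rw [this]
            simp only [mem_compl_iff, mem_ofPred_eq, not_lt, cy] at hz2
            rw [← ofReal_measureReal]
            exact ENNReal.ofReal_le_ofReal hz2
      _ = _ := by simp
  refine (measure_mono (hit_subset a n m hm)).trans ((measure_union_le _ _).trans ?_)
  rw [(hT.iterate _).measure_preimage hWm.nullMeasurableSet,
    (hT.iterate _).measure_preimage hWm.nullMeasurableSet, ← two_mul]
  gcongr

lemma final (hErg : Ergodic (shift 𝒜) μ) {K : ℕ} {r : ℝ} (hr : 0 ≤ r) (hr1 : r < 1)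
    (hB : μ (Bset μ K r) ≠ 0) : Tendsto
      (fun n => ⨆ a : ℕ → 𝒜,
        (μ {x | hitTime (shift 𝒜) {y | ∀ i < n, y i = a i} x ≤ (n : ℕ∞)}).toReal)
      atTop (𝓝 0) := by
  have hT := hErg.toMeasurePreserving
  rw [Metric.tendsto_atTop']
  intro ε hε
  obtain ⟨R, hR, hV⟩ := exists_R hErg hr hB (ENNReal.ofReal (ε / 16)) (by simp; positivity)
  -- the exponential term
  set q : ℕ → ℕ := fun n => ((n / 2 - K) / R) / 2
  have hq : Tendsto q atTop atTop := by
    refine (Nat.tendsto_div_const_atTop (by norm_num)).comp ((Nat.tendsto_div_const_atTop hR.ne').comp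
      ((tendsto_sub_atTop_nat K).comp (Nat.tendsto_div_const_atTop (by norm_num))))
  set A : ℕ := 2 * (K + 2 * R) + 2
  have hqb : ∀ n, n + 1 ≤ 4 * R * q n + A := by
    intro n
    have h1 : n / 2 - K < R * ((n / 2 - K) / R) + R := by
      have := Nat.lt_mul_div_succ (n / 2 - K) hR
      linarith
    have h2 : (n / 2 - K) / R ≤ 2 * q n + 1 := by simp only [q]; omega
    have h3 : R * ((n / 2 - K) / R) ≤ R * (2 * q n + 1) := Nat.mul_le_mul_left _ h2
    have h4 : R * (2 * q n + 1) = 2 * (R * q n) + R := by ring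
    have h5 : 4 * R * q n = 4 * (R * q n) := by ring
    simp only [A]
    omega
  have hlim : Tendsto (fun n : ℕ => (n + 1 : ℝ) * r ^ (q n)) atTop (𝓝 0) := by
    have habs : |r| < 1 := by rw [abs_of_nonneg hr]; exact hr1
    have e1 := (tendsto_pow_const_mul_const_pow_of_abs_lt_one 1 habs).const_mul (4 * R : ℝ)
    have e2 := (tendsto_pow_const_mul_const_pow_of_abs_lt_one 0 habs).const_mul (A : ℝ)
    have e3 := (e1.add e2).comp hq
    simp only [mul_zero, add_zero] at e3
    refine squeeze_zero (fun n => by positivity) (fun n => ?_) e3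
    simp only [Function.comp, pow_one, pow_zero, one_mul]
    have : (n + 1 : ℝ) ≤ 4 * R * q n + A := by exact_mod_cast hqb n
    calc _ ≤ (4 * R * q n + A) * r ^ q n := by gcongr
      _ = _ := by ring
  obtain ⟨N, hN⟩ := eventually_atTop.1
    ((hlim.eventually (gt_mem_nhds (by positivity : (0 : ℝ) < ε / 8))).and
      ((hq.eventually_gt_atTop 0)))
  refine ⟨N, fun n hn => ?_⟩
  obtain ⟨hn1, hn2⟩ := hN n hn.le
  set L := (n / 2 - K) / R
  have hL : 0 < L := by simp only [q] at hn2; omega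
  have hLR : K + L * R ≤ n / 2 := by
    have := Nat.div_mul_le_self (n / 2 - K) R
    have h2 : 0 < L * R := Nat.mul_pos hL hR
    simp only [L] at h2 ⊢; omega
  have hbad : μ {x | r ^ q n < cy μ (n / 2) x} ≤ 2 * ENNReal.ofReal (ε / 16) := by
    refine le_trans (measure_mono ?_) (bad_meas hT hr hr1 hV L hL)
    intro x hx
    exact lt_of_lt_of_le hx (cy_anti hLR x)
  have hall : ∀ a : ℕ → 𝒜,
      (μ {x | hitTime (shift 𝒜) {y | ∀ i < n, y i = a i} x ≤ (n : ℕ∞)}).toReal ≤ ε / 2 := by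
    intro a
    refine ENNReal.toReal_le_of_le_ofReal (by positivity) ?_
    refine (hit_bound hT a n (n / 2) (by omega) (r ^ q n)).trans ?_
    have e : ((n : ℝ≥0∞) + 1) * ENNReal.ofReal (r ^ q n) ≤ ENNReal.ofReal (ε / 8) := by
      have : ((n : ℝ≥0∞) + 1) = ENNReal.ofReal (n + 1 : ℝ) := by
        rw [ENNReal.ofReal_add (by positivity) (by norm_num)]; simp
      rw [this, ← ENNReal.ofReal_mul (by positivity)]
      exact ENNReal.ofReal_le_ofReal hn1.le
    have e2 : 2 * ENNReal.ofReal (ε / 16) = ENNReal.ofReal (ε / 8) := by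
      rw [← ENNReal.ofReal_ofNat, ← ENNReal.ofReal_mul (by norm_num)]
      congr 1; ring
    rw [e2] at hbad
    calc _ ≤ 2 * (ENNReal.ofReal (ε / 8) + ENNReal.ofReal (ε / 8)) := by gcongr
      _ = _ := by
        rw [← ENNReal.ofReal_add (by positivity) (by positivity), ← ENNReal.ofReal_ofNat,
          ← ENNReal.ofReal_mul (by norm_num)]
        congr 1; ring
  rw [Real.dist_eq, sub_zero, abs_of_nonneg (Real.iSup_nonneg fun a => ENNReal.toReal_nonneg)]
  have := Real.iSup_le hall (by positivity)
  linarith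


/-- the coordinates `1, …, n` -/
def pj (n : ℕ) (x : ℕ → 𝒜) : Fin n → 𝒜 := fun i => x (i + 1)

lemma measurable_pj (n : ℕ) : Measurable (pj n : (ℕ → 𝒜) → _) := measurable_proj n 1

def F0 (a : 𝒜) : Set (ℕ → 𝒜) := {y | y 0 = a}

lemma meas_F0 (a : 𝒜) : MeasurableSet (F0 a) := by
  have : F0 a = (fun y : ℕ → 𝒜 => y 0) ⁻¹' {a} := rfl
  rw [this]
  exact (measurable_pi_apply 0) (MeasurableSet.singleton a)

/-- conditional probability of `x 0 = a` given coordinates `1, …, n` -/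
def P (μ : Measure (ℕ → 𝒜)) (n : ℕ) (a : 𝒜) (w : Fin n → 𝒜) : ℝ :=
  μ.real (F0 a ∩ pj n ⁻¹' {w}) / μ.real (pj n ⁻¹' {w})

lemma P_nonneg (n : ℕ) (a : 𝒜) (w : Fin n → 𝒜) : 0 ≤ P μ n a w := by
  unfold P; positivity

lemma P_le_one (n : ℕ) (a : 𝒜) (w : Fin n → 𝒜) : P μ n a w ≤ 1 :=
  div_le_one_of_le₀ (measureReal_mono inter_subset_right) measureReal_nonneg

lemma P_mul (n : ℕ) (a : 𝒜) (w : Fin n → 𝒜) :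
    P μ n a w * μ.real (pj n ⁻¹' {w}) = μ.real (F0 a ∩ pj n ⁻¹' {w}) := by
  unfold P
  by_cases h : μ.real (pj n ⁻¹' {w}) = 0
  · have : μ.real (F0 a ∩ pj n ⁻¹' {w}) = 0 :=
      le_antisymm (h ▸ measureReal_mono inter_subset_right) measureReal_nonneg
    rw [h, this]; simp
  · field_simp

/-- filtration generated by the coordinates `≥ 1` -/
def Fil (𝒜 : Type*) [MeasurableSpace 𝒜] : Filtration ℕ (inferInstance : MeasurableSpace (ℕ → 𝒜)) where
  seq n := MeasurableSpace.comap (pj n) inferInstance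
  mono' := by
    intro m n hmn
    have h : (pj m : (ℕ → 𝒜) → _) = (fun (w : Fin n → 𝒜) (i : Fin m) => w (Fin.castLE hmn i)) ∘ pj n := by
      funext x i; simp [pj]
    change MeasurableSpace.comap (pj m) _ ≤ MeasurableSpace.comap (pj n) _
    rw [h, ← MeasurableSpace.comap_comp]
    apply MeasurableSpace.comap_mono
    apply Measurable.comap_le
    fun_prop
  le' n := Measurable.comap_le (by unfold pj; fun_prop)

lemma ae_fiber_pos (n : ℕ) : ∀ᵐ x ∂μ, μ (pj n ⁻¹' {pj n x}) ≠ 0 := by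
  have : ∀ᵐ x ∂μ, ∀ w : Fin n → 𝒜, pj n x = w → μ (pj n ⁻¹' {w}) ≠ 0 := by
    rw [ae_all_iff]
    intro w
    by_cases h : μ (pj n ⁻¹' {w}) = 0
    · have : ∀ᵐ x ∂μ, x ∉ pj n ⁻¹' {w} := measure_eq_zero_iff_ae_notMem.1 h
      filter_upwards [this] with x hx hxw
      exact absurd hxw hx
    · exact ae_of_all _ fun x _ => h
  filter_upwards [this] with x hx
  exact hx _ rfl

lemma condExp_eq (n : ℕ) (a : 𝒜) :
    μ[(F0 a).indicator (fun _ => (1 : ℝ)) | Fil 𝒜 n] =ᵐ[μ] fun x => P μ n a (pj n x) := by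
  filter_upwards [ae_fiber_pos (μ := μ) n] with x hx
  set ce := μ[(F0 a).indicator (fun _ => (1 : ℝ)) | Fil 𝒜 n]
  set s : Set (ℕ → 𝒜) := pj n ⁻¹' {pj n x}
  have hfac : ce.FactorsThrough (pj n) :=
    StronglyMeasurable.factorsThrough (stronglyMeasurable_condExp (m := Fil 𝒜 n))
  have hs : MeasurableSet[Fil 𝒜 n] s := ⟨{pj n x}, MeasurableSet.singleton _, rfl⟩
  have hs' : MeasurableSet s := (Fil 𝒜).le n _ hs
  have hint : Integrable ((F0 a).indicator (fun _ => (1 : ℝ))) μ :=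
    (integrable_const 1).indicator (meas_F0 a)
  have h1 := setIntegral_condExp (μ := μ) ((Fil 𝒜).le n) hint hs
  have h2 : ∫ y in s, ce y ∂μ = μ.real s * ce x := by
    rw [setIntegral_congr_fun (g := fun _ => ce x) hs' (fun y hy => hfac hy)]
    simp
  have h3 : ∫ y in s, (F0 a).indicator (fun _ => (1 : ℝ)) y ∂μ = μ.real (F0 a ∩ s) := by
    rw [integral_indicator (meas_F0 a), Measure.restrict_restrict (meas_F0 a)]
    simp
  have hpos : μ.real s ≠ 0 := by
    rw [measureReal_def]; exact ENNReal.toReal_ne_zero.2 ⟨hx, measure_ne_top _ _⟩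
  have h4 : μ.real s * ce x = μ.real (F0 a ∩ s) := by rw [← h2, ← h3]; exact h1
  unfold P
  rw [eq_div_iff hpos, mul_comm]; exact h4

/-- limiting conditional probability -/
def Q (μ : Measure (ℕ → 𝒜)) (a : 𝒜) : (ℕ → 𝒜) → ℝ :=
  μ[(F0 a).indicator (fun _ => (1 : ℝ)) | ⨆ n, Fil 𝒜 n]

lemma tendsto_P : ∀ᵐ x ∂μ, ∀ a : 𝒜, Tendsto (fun n => P μ n a (pj n x)) atTop (𝓝 (Q μ a x)) := by
  rw [ae_all_iff]
  intro a
  have h1 := tendsto_ae_condExp (μ := μ) (ℱ := Fil 𝒜) ((F0 a).indicator (fun _ => (1 : ℝ)))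
  have h2 : ∀ᵐ x ∂μ, ∀ n, (μ[(F0 a).indicator (fun _ => (1 : ℝ)) | Fil 𝒜 n]) x = P μ n a (pj n x) :=
    ae_all_iff.2 fun n => condExp_eq n a
  filter_upwards [h1, h2] with x hx1 hx2
  simp only [hx2] at hx1
  exact hx1

lemma integral_Q (a : 𝒜) : ∫ x, Q μ a x ∂μ = μ.real (F0 a) := by
  unfold Q
  rw [integral_condExp (iSup_le fun n => (Fil 𝒜).le n)]
  rw [integral_indicator (meas_F0 a)]; simp

lemma integral_P (n : ℕ) (a : 𝒜) : ∫ x, P μ n a (pj n x) ∂μ = μ.real (F0 a) := by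
  rw [← integral_congr_ae (condExp_eq n a), integral_condExp ((Fil 𝒜).le n)]
  rw [integral_indicator (meas_F0 a)]; simp

lemma exists_B (hT : MeasurePreserving (shift 𝒜) μ μ)
    (hQ : ¬ ∀ᵐ x ∂μ, 1 ≤ Q μ (x 0) x) : ∃ (K : ℕ) (r : ℝ), 0 ≤ r ∧ r < 1 ∧ μ (Bset μ K r) ≠ 0 := by
  by_contra hcon
  push Not at hcon
  apply hQ
  have hB : ∀ᵐ x ∂μ, ∀ K j : ℕ, x ∉ Bset μ K (1 - 1 / ((j : ℝ) + 1)) := by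
    rw [ae_all_iff]; intro K
    rw [ae_all_iff]; intro j
    apply measure_eq_zero_iff_ae_notMem.1
    apply hcon
    · rw [sub_nonneg, div_le_one (by positivity)]; linarith [(Nat.cast_nonneg j : (0 : ℝ) ≤ j)]
    · have : 0 < 1 / ((j : ℝ) + 1) := by positivity
      linarith
  filter_upwards [hB, tendsto_P (μ := μ)] with x hx hlim
  by_contra hlt
  push Not at hlt
  obtain ⟨j, hj⟩ := exists_nat_one_div_lt (sub_pos.2 hlt)
  have hev := (hlim (x 0)).eventually (gt_mem_nhds (by linarith : Q μ (x 0) x < 1 - 1 / ((j : ℝ) + 1)))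
  obtain ⟨K, hK⟩ := eventually_atTop.1 hev
  refine hx K j fun k hk => ?_
  have h1 : cy μ (k + 1) x = μ.real (F0 (x 0) ∩ pj k ⁻¹' {pj k x}) := by
    unfold cy; congr 1; ext y
    simp only [mem_ofPred_eq, F0, mem_inter_iff, mem_preimage, mem_singleton_iff, funext_iff, pj,
      Fin.forall_iff]
    constructor
    · exact fun h => ⟨h 0 (by omega), fun i hi => h (i + 1) (by omega)⟩
    · rintro ⟨h0, h⟩ i hi
      rcases i with _ | i
      · exact h0
      · exact h i (by omega)
  have h2 : cy μ k (shift 𝒜 x) = μ.real (pj k ⁻¹' {pj k x}) := by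
    rw [cy_shift hT]; congr 1; ext y
    simp only [mem_ofPred_eq, mem_preimage, mem_singleton_iff, funext_iff, pj, Fin.forall_iff]
  rw [h1, h2, ← P_mul]
  exact mul_le_mul_of_nonneg_right (hK k hk).le measureReal_nonneg

/-- entropy of rank `n` cylinders -/
def HH (μ : Measure (ℕ → 𝒜)) (n : ℕ) : ℝ≥0∞ :=
  ∑' w : Fin n → 𝒜, ENNReal.ofReal (Real.negMulLog (μ.real {y | ∀ i : Fin n, y (i : ℕ) = w i}))

/-- conditional entropy -/
def DD (μ : Measure (ℕ → 𝒜)) (n : ℕ) : ℝ≥0∞ :=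
  ∑' a : 𝒜, ∫⁻ x, ENNReal.ofReal (Real.negMulLog (P μ n a (pj n x))) ∂μ

lemma entropySeq_eq (n : ℕ) : entropySeq μ n = (n : ℝ)⁻¹ * (HH μ n).toReal := by
  unfold entropySeq HH
  rw [ENNReal.tsum_toReal_eq (fun _ => ENNReal.ofReal_ne_top)]
  rw [one_div, neg_mul, ← mul_neg, ← tsum_neg]
  congr 2
  funext w
  rw [ENNReal.toReal_ofReal (Real.negMulLog_nonneg measureReal_nonneg measureReal_le_one)]
  simp [Real.negMulLog, measureReal_def]

lemma cyl_eq (hT : MeasurePreserving (shift 𝒜) μ μ) (n : ℕ) (w : Fin n → 𝒜) :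
    μ.real {y | ∀ i : Fin n, y (i : ℕ) = w i} = μ.real (pj n ⁻¹' {w}) := by
  have hm : MeasurableSet {y : ℕ → 𝒜 | ∀ i : Fin n, y (i : ℕ) = w i} := by
    have : {y : ℕ → 𝒜 | ∀ i : Fin n, y (i : ℕ) = w i} =
        (fun (x : ℕ → 𝒜) (i : Fin n) => x (i + 0)) ⁻¹' {w} := by
      ext y; simp [funext_iff]
    rw [this]
    exact measurable_proj n 0 (MeasurableSet.singleton w)
  rw [← hT.measureReal_preimage hm.nullMeasurableSet]
  congr 1; ext y
  simp [pj, shift, funext_iff]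

lemma tsum_P (n : ℕ) (w : Fin n → 𝒜) :
    ∑' a : 𝒜, μ (F0 a ∩ pj n ⁻¹' {w}) = μ (pj n ⁻¹' {w}) := by
  rw [← measure_iUnion]
  · congr 1; ext y; simp [F0]
  · intro a b hab
    rw [Function.onFun, Set.disjoint_left]
    rintro y ⟨h1, -⟩ ⟨h2, -⟩
    exact hab (h1.symm.trans h2)
  · exact fun a => (meas_F0 a).inter (measurable_pj n (MeasurableSet.singleton w))

lemma HH_succ (hT : MeasurePreserving (shift 𝒜) μ μ) (n : ℕ) :
    HH μ (n + 1) = HH μ n + DD μ n := by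
  have hD : DD μ n = ∑' (a : 𝒜) (w : Fin n → 𝒜),
      ENNReal.ofReal (Real.negMulLog (P μ n a w)) * μ (pj n ⁻¹' {w}) := by
    unfold DD
    congr 1; funext a
    rw [← lintegral_map (f := fun w => ENNReal.ofReal (Real.negMulLog (P μ n a w)))
      Measurable.of_discrete (measurable_pj n), lintegral_countable']
    congr 1; funext w
    rw [Measure.map_apply (measurable_pj n) (MeasurableSet.singleton w)]
  have hH : HH μ n = ∑' (a : 𝒜) (w : Fin n → 𝒜),
      ENNReal.ofReal (Real.negMulLog (μ.real (pj n ⁻¹' {w}))) * ENNReal.ofReal (P μ n a w) := by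
    rw [ENNReal.tsum_comm]
    unfold HH
    congr 1; funext w
    rw [ENNReal.tsum_mul_left, cyl_eq hT]
    by_cases h0 : μ (pj n ⁻¹' {w}) = 0
    · simp [measureReal_def, h0]
    · have : ∑' a : 𝒜, ENNReal.ofReal (P μ n a w) = 1 := by
        have h1 : (∑' a : 𝒜, ENNReal.ofReal (P μ n a w)) * μ (pj n ⁻¹' {w}) = 1 * μ (pj n ⁻¹' {w}) := by
          rw [← ENNReal.tsum_mul_right, one_mul, ← tsum_P n w]
          congr 1; funext a
          rw [← ofReal_measureReal (s := F0 a ∩ _), ← P_mul, ENNReal.ofReal_mul (P_nonneg _ _ _),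
            ofReal_measureReal, tsum_P]
        exact (ENNReal.mul_left_inj h0 (measure_ne_top _ _)).1 h1
      rw [this, mul_one]
  rw [hD, hH, ← ENNReal.tsum_add]
  simp_rw [← ENNReal.tsum_add]
  unfold HH
  rw [← (Fin.consEquiv (fun _ : Fin (n + 1) => 𝒜)).tsum_eq, ENNReal.tsum_prod']
  congr 1; funext a; congr 1; funext w
  have hset : {y : ℕ → 𝒜 | ∀ i : Fin (n + 1), y (i : ℕ) =
      (Fin.consEquiv (fun _ : Fin (n + 1) => 𝒜)) (a, w) i} = F0 a ∩ pj n ⁻¹' {w} := by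
    ext y
    simp [Fin.forall_fin_succ, Fin.consEquiv, F0, pj, funext_iff]
  rw [hset, ← P_mul, Real.negMulLog_mul, add_comm, ENNReal.ofReal_add, mul_comm (P μ n a w),
    ENNReal.ofReal_mul, mul_comm (μ.real _), ENNReal.ofReal_mul, ofReal_measureReal]
  · exact Real.negMulLog_nonneg (P_nonneg _ _ _) (P_le_one _ _ _)
  · exact Real.negMulLog_nonneg measureReal_nonneg measureReal_le_one
  · exact mul_nonneg (P_nonneg _ _ _) (Real.negMulLog_nonneg measureReal_nonneg measureReal_le_one)
  · exact mul_nonneg measureReal_nonneg (Real.negMulLog_nonneg (P_nonneg _ _ _) (P_le_one _ _ _))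

lemma negMulLog_le_one {t : ℝ} (h0 : 0 ≤ t) (_h1 : t ≤ 1) : Real.negMulLog t ≤ 1 := by
  have := Real.negMulLog_le_one_sub_self h0
  linarith

lemma meas_term (n : ℕ) (a : 𝒜) : Measurable (fun x => Real.negMulLog (P μ n a (pj n x))) :=
  (Measurable.of_discrete (f := fun w => Real.negMulLog (P μ n a w))).comp (measurable_pj n)

lemma jensen (n : ℕ) (a : 𝒜) :
    ∫⁻ x, ENNReal.ofReal (Real.negMulLog (P μ n a (pj n x))) ∂μ ≤
      ENNReal.ofReal (Real.negMulLog (μ.real (F0 a))) := by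
  have hi : Integrable (fun x => Real.negMulLog (P μ n a (pj n x))) μ := by
    refine Integrable.of_bound (meas_term n a).aestronglyMeasurable 1 (ae_of_all _ fun x => ?_)
    rw [Real.norm_of_nonneg (Real.negMulLog_nonneg (P_nonneg _ _ _) (P_le_one _ _ _))]
    exact negMulLog_le_one (P_nonneg _ _ _) (P_le_one _ _ _)
  have hi2 : Integrable (fun x => P μ n a (pj n x)) μ := by
    refine Integrable.of_bound ((Measurable.of_discrete (f := P μ n a)).comp
      (measurable_pj n)).aestronglyMeasurable 1 (ae_of_all _ fun x => ?_)
    rw [Real.norm_of_nonneg (P_nonneg _ _ _)]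
    exact P_le_one _ _ _
  rw [← ofReal_integral_eq_lintegral_ofReal hi (ae_of_all _ fun x =>
    Real.negMulLog_nonneg (P_nonneg _ _ _) (P_le_one _ _ _))]
  apply ENNReal.ofReal_le_ofReal
  rw [← integral_P n a]
  exact Real.concaveOn_negMulLog.le_map_integral Real.continuous_negMulLog.continuousOn isClosed_Ici
    (ae_of_all _ fun x => P_nonneg _ _ _) hi2 hi

lemma HH_zero : HH μ 0 = 0 := by simp [HH]

lemma HH_one : HH μ 1 = ∑' a : 𝒜, ENNReal.ofReal (Real.negMulLog (μ.real (F0 a))) := by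
  unfold HH
  rw [← (Equiv.funUnique (Fin 1) 𝒜).symm.tsum_eq]
  congr 1; funext a; congr 3
  ext y; simp [F0]

lemma DD_le (n : ℕ) : DD μ n ≤ HH μ 1 := by
  rw [HH_one]
  exact ENNReal.tsum_le_tsum fun a => jensen n a

lemma DD_tendsto (hQ : ∀ᵐ x ∂μ, 1 ≤ Q μ (x 0) x) (hfin : HH μ 1 ≠ ⊤) :
    Tendsto (DD μ) atTop (𝓝 0) := by
  have hQ01 : ∀ᵐ x ∂μ, ∀ a, Real.negMulLog (Q μ a x) = 0 := by
    rw [ae_all_iff]; intro a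
    have hb : ∀ᵐ x ∂μ, 0 ≤ Q μ a x ∧ Q μ a x ≤ 1 := by
      filter_upwards [tendsto_P (μ := μ)] with x hx
      exact ⟨ge_of_tendsto' (hx a) fun n => P_nonneg _ _ _,
        le_of_tendsto' (hx a) fun n => P_le_one _ _ _⟩
    have hge : (F0 a).indicator (fun _ => (1 : ℝ)) ≤ᵐ[μ] Q μ a := by
      filter_upwards [hb, hQ] with x hx hx2
      by_cases h : x ∈ F0 a
      · rw [indicator_of_mem h]
        have h' : x 0 = a := h
        rwa [h'] at hx2
      · rw [indicator_of_notMem h]; exact hx.1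
    have hint : Integrable ((F0 a).indicator (fun _ => (1 : ℝ))) μ :=
      (integrable_const 1).indicator (meas_F0 a)
    have heq : (F0 a).indicator (fun _ => (1 : ℝ)) =ᵐ[μ] Q μ a := by
      refine (integral_eq_iff_of_ae_le hint integrable_condExp hge).1 ?_
      rw [integral_indicator (meas_F0 a)]
      refine Eq.trans ?_ (integral_Q a).symm
      simp
    filter_upwards [heq] with x hx
    rw [← hx]
    by_cases h : x ∈ F0 a
    · simp [indicator_of_mem h]
    · simp [indicator_of_notMem h]
  have hterm : ∀ a, Tendsto (fun n => ∫⁻ x, ENNReal.ofReal (Real.negMulLog (P μ n a (pj n x))) ∂μ)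
      atTop (𝓝 0) := by
    intro a
    have := tendsto_lintegral_of_dominated_convergence (μ := μ)
      (F := fun n x => ENNReal.ofReal (Real.negMulLog (P μ n a (pj n x)))) (f := fun _ => 0)
      (fun _ => 1) (fun n => (meas_term n a).ennreal_ofReal) (fun n => ae_of_all _ fun x => ?_)
      (by simp) ?_
    · simpa using this
    · rw [← ENNReal.ofReal_one]
      exact ENNReal.ofReal_le_ofReal (negMulLog_le_one (P_nonneg _ _ _) (P_le_one _ _ _))
    · filter_upwards [hQ01, tendsto_P (μ := μ)] with x h1 h2
      have := ENNReal.tendsto_ofReal ((Real.continuous_negMulLog.tendsto _).comp (h2 a))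
      rw [h1 a, ENNReal.ofReal_zero] at this
      exact this
  have := tendsto_lintegral_of_dominated_convergence (μ := (Measure.count : Measure 𝒜))
    (F := fun n a => ∫⁻ x, ENNReal.ofReal (Real.negMulLog (P μ n a (pj n x))) ∂μ) (f := fun _ => 0)
    (fun a => ENNReal.ofReal (Real.negMulLog (μ.real (F0 a)))) (fun n => Measurable.of_discrete)
    (fun n => ae_of_all _ fun a => jensen n a) (by rw [lintegral_count, ← HH_one]; exact hfin)
    (ae_of_all _ hterm)
  simp only [lintegral_count, tsum_zero] at this
  exact this

lemma entropy_zero (hT : MeasurePreserving (shift 𝒜) μ μ) (hQ : ∀ᵐ x ∂μ, 1 ≤ Q μ (x 0) x) :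
    Tendsto (entropySeq μ) atTop (𝓝 0) := by
  by_cases hfin : HH μ 1 = ⊤
  · have htop : ∀ n, HH μ (n + 1) = ⊤ := by
      intro n
      induction n with
      | zero => exact hfin
      | succ n ih => rw [HH_succ hT, ih, top_add]
    refine tendsto_const_nhds.congr' ?_
    filter_upwards [eventually_gt_atTop 0] with n hn
    obtain ⟨m, rfl⟩ : ∃ m, n = m + 1 := ⟨n - 1, by omega⟩
    rw [entropySeq_eq, htop]; simp
  · have hDfin : ∀ n, DD μ n ≠ ⊤ := fun n => ne_top_of_le_ne_top hfin (DD_le n)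
    have hsum : ∀ n, HH μ n = ∑ k ∈ Finset.range n, DD μ k := by
      intro n
      induction n with
      | zero => simp [HH_zero]
      | succ n ih => rw [HH_succ hT, ih, Finset.sum_range_succ]
    have h1 := (ENNReal.tendsto_toReal (by simp)).comp (DD_tendsto hQ hfin)
    have h2 := h1.cesaro
    simp only [ENNReal.toReal_zero] at h2
    refine h2.congr fun n => ?_
    rw [entropySeq_eq, hsum, ENNReal.toReal_sum fun k _ => hDfin k]
    rfl

end HitCyl

/-- **Hitting a cylinder within its own length is unlikely, uniformly.**
For an ergodic shift system with positive entropy `h_μ(T) > 0`,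
`sup_{a ∈ Σ} μ(τ_{[a_0…a_{n-1}]} ≤ n) → 0` as `n → ∞`; the probability of hitting the
cylinder of rank `n` around any point `a` (including periodic points) within `n` steps
tends to zero, uniformly in `a`. -/
theorem sup_hitting_cylinder_tendsto_zero
    {𝒜 : Type*} [Countable 𝒜] [MeasurableSpace 𝒜] [DiscreteMeasurableSpace 𝒜]
    (μ : Measure (ℕ → 𝒜)) [IsProbabilityMeasure μ]
    (hErg : Ergodic (shift 𝒜) μ)
    (h : ℝ) (hent : Tendsto (entropySeq μ) atTop (𝓝 h)) (hpos : 0 < h) :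
    Tendsto
      (fun n => ⨆ a : ℕ → 𝒜,
        (μ {x | hitTime (shift 𝒜) {y | ∀ i < n, y i = a i} x ≤ (n : ℕ∞)}).toReal)
      atTop (𝓝 0) := by
  have hT := hErg.toMeasurePreserving
  have hQ : ¬ ∀ᵐ x ∂μ, 1 ≤ HitCyl.Q μ (x 0) x := by
    intro hQ
    have := tendsto_nhds_unique hent (HitCyl.entropy_zero hT hQ)
    linarith
  obtain ⟨K, r, hr0, hr1, hB⟩ := HitCyl.exists_B hT hQ
  exact HitCyl.final hErg hr0 hr1 hB
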